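/- arXiv:2404.02364 — 9 statements merged into one kernel-verified Lean document; each statement's English description precedes it below -/
import Mathlib

section
/- Let k ≥ 1 be an integer, ε ∈ (0, 1/k), and let v¹,…,vᵏ be an orthonormal family in ℝᵈ. Let v = ∑_{i=1}^k λᵢ vⁱ with ∑_{i=1}^k λᵢ² = 1 and each λᵢ ∈ [−1,1], and let j₁,…,j_k be integers with |λᵢ − ε jᵢ| ≤ ε for each i. Then the vector u = ε·∑_{i=1}^k jᵢ vⁱ satisfies v·u ≥ 1 − kε, ‖u‖₂ ≤ 1 + 3√(kε), and consequently cos ∠(u, v) ≥ (1 − kε)/(1 + 3√(kε)) ≥ 1 − 4√(kε). -/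
open scoped RealInnerProductSpace
open InnerProductGeometry

/-- Pythagoras for a linear combination of an orthonormal family. -/
lemma Orthonormal.norm_sum_smul_sq {ι E : Type*} [Fintype ι] [NormedAddCommGroup E]
    [InnerProductSpace ℝ E] {v : ι → E} (hv : Orthonormal ℝ v) (a : ι → ℝ) :
    ‖∑ i, a i • v i‖ ^ 2 = ∑ i, a i ^ 2 := by
  rw [← real_inner_self_eq_norm_sq, hv.inner_sum]
  simp [sq]

/-- Rounding the coefficients of a unit vector in the span of an
orthonormal family yields a vector at small angular distance. -/
theorem round_coefficients_small_angle
    (d k : ℕ) (hk : 1 ≤ k)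
    (ε : ℝ) (hε : 0 < ε) (hεk : ε < 1 / k)
    (v : Fin k → EuclideanSpace ℝ (Fin d)) (hv : Orthonormal ℝ v)
    (lam : Fin k → ℝ) (w : EuclideanSpace ℝ (Fin d))
    (hw : w = ∑ i, lam i • v i)
    (hlam : ∑ i, (lam i) ^ 2 = 1)
    (hlam' : ∀ i, -1 ≤ lam i ∧ lam i ≤ 1)
    (j : Fin k → ℤ) (hj : ∀ i, |lam i - ε * (j i : ℝ)| ≤ ε)
    (u : EuclideanSpace ℝ (Fin d)) (hu : u = ε • ∑ i, (j i : ℝ) • v i) :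
    1 - (k : ℝ) * ε ≤ ⟪w, u⟫ ∧
    ‖u‖ ≤ 1 + 3 * Real.sqrt ((k : ℝ) * ε) ∧
    (1 - (k : ℝ) * ε) / (1 + 3 * Real.sqrt ((k : ℝ) * ε)) ≤ Real.cos (angle u w) ∧
    1 - 4 * Real.sqrt ((k : ℝ) * ε) ≤
      (1 - (k : ℝ) * ε) / (1 + 3 * Real.sqrt ((k : ℝ) * ε)) := by
  have hk0 : (1 : ℝ) ≤ k := by exact_mod_cast hk
  have hkε : (k : ℝ) * ε < 1 := by
    rwa [lt_div_iff₀ (by linarith), mul_comm] at hεk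
  have hε1 : ε ≤ 1 := by nlinarith
  have hkε0 : 0 ≤ (k : ℝ) * ε := by positivity
  have hu' : u = ∑ i, (ε * (j i : ℝ)) • v i := by
    simp only [hu, Finset.smul_sum, smul_smul]
  have hw1 : ‖w‖ = 1 := by
    have h := hv.norm_sum_smul_sq lam
    rw [← hw, hlam] at h
    exact (pow_eq_one_iff_of_nonneg (norm_nonneg w) two_ne_zero).mp h
  have hinner : 1 - (k : ℝ) * ε ≤ ⟪w, u⟫ := by
    have h : ∀ i, lam i ^ 2 - ε ≤ lam i * (ε * (j i : ℝ)) := fun i => by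
      have h1 : |lam i * (lam i - ε * j i)| ≤ 1 * ε := by
        rw [abs_mul]
        exact mul_le_mul (abs_le.mpr (hlam' i)) (hj i) (abs_nonneg _) zero_le_one
      linarith [le_abs_self (lam i * (lam i - ε * j i))]
    have hsum := Finset.sum_le_sum fun i (_ : i ∈ Finset.univ) => h i
    rw [Finset.sum_sub_distrib, hlam] at hsum
    rw [hw, hu', hv.inner_sum]
    simpa using hsum
  have hdist : ‖u - w‖ ≤ √((k : ℝ) * ε) := by
    apply Real.le_sqrt_of_sq_le
    rw [hu', hw, ← Finset.sum_sub_distrib]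
    simp only [← sub_smul]
    rw [hv.norm_sum_smul_sq]
    calc ∑ i, (ε * (j i : ℝ) - lam i) ^ 2 ≤ ∑ _i : Fin k, ε := by
          refine Finset.sum_le_sum fun i _ => ?_
          have h := abs_le.mp (hj i)
          nlinarith
      _ = k * ε := by simp
  have hs0 : 0 ≤ √((k : ℝ) * ε) := Real.sqrt_nonneg _
  have hnorm : ‖u‖ ≤ 1 + 3 * √((k : ℝ) * ε) := by
    linarith [norm_le_norm_add_norm_sub' u w]
  refine ⟨hinner, hnorm, ?_, ?_⟩
  · have hu0 : 0 < ‖u‖ := by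
      refine norm_pos_iff.mpr fun h => ?_
      rw [h, inner_zero_right] at hinner
      linarith
    rw [cos_angle, hw1, mul_one, real_inner_comm]
    exact div_le_div₀ (by linarith) hinner hu0 hnorm
  · rw [le_div_iff₀ (by linarith)]
    nlinarith [Real.sq_sqrt hkε0]
end

section
/- Let ε ∈ (0, 1/2), let ŵ be a unit vector in ℝᵈ, and let X be a nonempty finite multiset (list) of points in ℝᵈ such that: (i) the fraction of x ∈ X with |ŵ·x| ≤ 2ε^{2/3} is at most 5ε^{2/3}, and (ii) for every unit vector v ∈ ℝᵈ, the empirical second moment (1/|X|)·∑_{x∈X} (v·x)² is at most 2. Then for every unit vector w ∈ ℝᵈ with ∠(w, ŵ) ≤ ε, the fraction of x ∈ X with sign(w·x) ≠ sign(ŵ·x) is at most 7ε^{2/3}. -/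
open scoped RealInnerProductSpace
open InnerProductGeometry

/-- The fraction of elements of the list (multiset) `X` satisfying the property `P`. -/
noncomputable def frac {α : Type*} (X : List α) (P : α → Prop) : ℝ :=
  ((X.countP fun x => @decide (P x) (Classical.propDecidable _)) : ℝ) / (X.length : ℝ)

/-- `sign(z) = 1` if `z ≥ 0`, and `−1` if `z < 0`. -/
noncomputable def sgn (z : ℝ) : ℝ := if 0 ≤ z then 1 else -1

/-- Chebyshev-type bound: if every element satisfying `P` satisfies `Q` or has `c ≤ f x`, then
the fraction for `P` is at most the fraction for `Q` plus the mean of `f` over `c`. -/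
lemma frac_le_frac_add_mean_div {α : Type*} (X : List α) (P Q : α → Prop) (f : α → ℝ) (c : ℝ)
    (hc : 0 < c) (hf : ∀ x, 0 ≤ f x) (h : ∀ x, P x → Q x ∨ c ≤ f x) :
    frac X P ≤ frac X Q + (X.map f).sum / (X.length : ℝ) / c := by
  classical
  have key : ((X.countP fun x => @decide (P x) (Classical.propDecidable _)) : ℝ) ≤
      ((X.countP fun x => @decide (Q x) (Classical.propDecidable _)) : ℝ)
        + (X.map f).sum / c := by
    induction X with
    | nil => simp
    | cons a X ih =>
      have h0 : 0 ≤ f a / c := div_nonneg (hf a) hc.le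
      have h3 : P a → Q a ∨ 1 ≤ f a / c := fun hp =>
        (h a hp).imp_right fun h' => (one_le_div hc).2 h'
      simp only [List.countP_cons, List.map_cons, List.sum_cons, add_div, Nat.cast_add,
        decide_eq_true_eq, Nat.cast_ite, Nat.cast_one, Nat.cast_zero]
      by_cases hp : P a <;> by_cases hq : Q a <;> simp only [hp, hq, if_true, if_false] <;>
        first
        | linarith
        | (have := (h3 hp).resolve_left hq; linarith)
  unfold frac
  rw [div_right_comm, ← add_div]
  exact div_le_div_of_nonneg_right key (Nat.cast_nonneg _)

/-- A second moment bound on unit vectors extends to all vectors by homogeneity. -/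
lemma second_moment_le_mul_norm_sq {E : Type*} [NormedAddCommGroup E] [InnerProductSpace ℝ E]
    (X : List E) (C : ℝ)
    (h : ∀ v : E, ‖v‖ = 1 → (X.map fun x => ⟪v, x⟫ ^ 2).sum / (X.length : ℝ) ≤ C) (u : E) :
    (X.map fun x => ⟪u, x⟫ ^ 2).sum / (X.length : ℝ) ≤ C * ‖u‖ ^ 2 := by
  rcases eq_or_ne u 0 with rfl | hu
  · simp
  have hn : 0 < ‖u‖ := norm_pos_iff.2 hu
  have hv := h (‖u‖⁻¹ • u) (norm_smul_inv_norm hu)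
  simp only [real_inner_smul_left, mul_pow, List.sum_map_mul_left] at hv
  rw [mul_div_assoc, inv_pow, inv_mul_le_iff₀ (by positivity)] at hv
  linarith

/-- The chord between two unit vectors is no longer than the angle between them. -/
lemma norm_sub_sq_le_angle_sq {E : Type*} [NormedAddCommGroup E] [InnerProductSpace ℝ E]
    {v w : E} (hv : ‖v‖ = 1) (hw : ‖w‖ = 1) : ‖v - w‖ ^ 2 ≤ angle v w ^ 2 := by
  have h := Real.one_sub_sq_div_two_le_cos (x := angle v w)
  rw [cos_angle, hv, hw] at h
  rw [norm_sub_sq_real, hv, hw]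
  linarith

/-- Two reals with different signs are at least as far apart as the second is from zero. -/
lemma abs_le_abs_sub_of_sgn_ne {a b : ℝ} (h : sgn a ≠ sgn b) : |b| ≤ |a - b| := by
  unfold sgn at h
  split_ifs at h with ha hb hb
  · exact absurd rfl h
  · rw [abs_of_neg (by linarith), abs_of_nonneg (by linarith)]; linarith
  · rw [abs_of_nonneg hb, abs_of_neg (by linarith)]; linarith
  · exact absurd rfl h

/-- Tester for local homogeneous halfspace disagreement: soundness. -/
theorem local_homogeneous_halfspace_disagreement
    (d : ℕ) (ε : ℝ) (hε0 : 0 < ε) (hε2 : ε < 1/2)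
    (wh : EuclideanSpace ℝ (Fin d)) (hwh : ‖wh‖ = 1)
    (X : List (EuclideanSpace ℝ (Fin d))) (hX : X ≠ [])
    (h1 : frac X (fun x => |⟪wh, x⟫| ≤ 2 * ε ^ ((2 : ℝ)/3)) ≤ 5 * ε ^ ((2 : ℝ)/3))
    (h2 : ∀ v : EuclideanSpace ℝ (Fin d), ‖v‖ = 1 →
      (X.map fun x => ⟪v, x⟫ ^ 2).sum / (X.length : ℝ) ≤ 2) :
    ∀ w : EuclideanSpace ℝ (Fin d), ‖w‖ = 1 → angle w wh ≤ ε →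
      frac X (fun x => sgn ⟪w, x⟫ ≠ sgn ⟪wh, x⟫) ≤ 7 * ε ^ ((2 : ℝ)/3) := by
  intro w hw hangle
  set t : ℝ := ε ^ ((2 : ℝ)/3) with ht
  have ht0 : 0 < t := Real.rpow_pos_of_pos hε0 _
  have ht3 : t ^ 3 = ε ^ 2 := by
    rw [ht, ← Real.rpow_natCast, ← Real.rpow_mul hε0.le, ← Real.rpow_natCast]
    norm_num
  have hmean : (X.map fun x => ⟪w - wh, x⟫ ^ 2).sum / (X.length : ℝ) ≤ 2 * ε ^ 2 := by
    have hnorm := norm_sub_sq_le_angle_sq hw hwh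
    have hsq := pow_le_pow_left₀ (angle_nonneg w wh) hangle 2
    linarith [second_moment_le_mul_norm_sq X 2 h2 (w - wh)]
  have hcheb := frac_le_frac_add_mean_div X (fun x => sgn ⟪w, x⟫ ≠ sgn ⟪wh, x⟫)
    (fun x => |⟪wh, x⟫| ≤ 2 * t) (fun x => ⟪w - wh, x⟫ ^ 2) ((2 * t) ^ 2) (by positivity)
    (fun x => sq_nonneg _) fun x hx => by
      refine or_iff_not_imp_left.2 fun hfar => ?_
      rw [← sq_abs ⟪w - wh, x⟫, inner_sub_left]
      exact pow_le_pow_left₀ (by positivity)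
        ((not_le.1 hfar).le.trans (abs_le_abs_sub_of_sgn_ne hx)) 2
  have htail : (X.map fun x => ⟪w - wh, x⟫ ^ 2).sum / (X.length : ℝ) / (2 * t) ^ 2 ≤ 2 * t := by
    rw [div_le_iff₀ (by positivity)]
    nlinarith [sq_nonneg ε]
  linarith
end

section
/- Let ε ∈ (0, 1/2), let w, ŵ be distinct unit vectors in ℝᵈ with ∠(w, ŵ) ≤ ε, and let v = (w − (w·ŵ)ŵ) / ‖w − (w·ŵ)ŵ‖₂. Then for every x ∈ ℝᵈ with sign(w·x) ≠ sign(ŵ·x) and |ŵ·x| > 2ε^{2/3}, it holds that |v·x| ≥ 2ε^{2/3} / tan ε. -/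
open scoped RealInnerProductSpace
open InnerProductGeometry

/-- If two unit vectors `w, wh` are at angle at most `ε` and their homogeneous
halfspaces disagree on `x` while `|wh·x| > 2ε^{2/3}`, then the normalized component `v` of `w`
orthogonal to `wh` satisfies `|v·x| ≥ 2ε^{2/3}/tan ε`. -/
theorem disagreement_point_large_orthogonal_component
    (d : ℕ) (ε : ℝ) (hε0 : 0 < ε) (hε2 : ε < 1/2)
    (w wh : EuclideanSpace ℝ (Fin d)) (hw : ‖w‖ = 1) (hwh : ‖wh‖ = 1)
    (hne : w ≠ wh) (hangle : angle w wh ≤ ε)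
    (v : EuclideanSpace ℝ (Fin d))
    (hv : v = ‖w - ⟪w, wh⟫ • wh‖⁻¹ • (w - ⟪w, wh⟫ • wh)) :
    ∀ x : EuclideanSpace ℝ (Fin d),
      sgn ⟪w, x⟫ ≠ sgn ⟪wh, x⟫ → 2 * ε ^ ((2 : ℝ)/3) < |⟪wh, x⟫| →
        2 * ε ^ ((2 : ℝ)/3) / Real.tan ε ≤ |⟪v, x⟫| := by
  intro x hsgn hx
  set t := 2 * ε ^ ((2 : ℝ)/3)
  have hpi := Real.pi_gt_three
  have hθ0 : 0 ≤ angle w wh := angle_nonneg w wh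
  have hcos : ⟪w, wh⟫ = Real.cos (angle w wh) := by
    rw [cos_angle, hw, hwh]; simp
  have hc : 0 < Real.cos (angle w wh) :=
    Real.cos_pos_of_mem_Ioo ⟨by linarith, by linarith⟩
  have hcε : 0 < Real.cos ε := Real.cos_pos_of_mem_Ioo ⟨by linarith, by linarith⟩
  have hsε : 0 < Real.sin ε := Real.sin_pos_of_pos_of_lt_pi hε0 (by linarith)
  have hsin : 0 ≤ Real.sin (angle w wh) := sin_angle_nonneg w wh
  have hnorm : ‖w - ⟪w, wh⟫ • wh‖ = Real.sin (angle w wh) := by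
    rw [← sq_eq_sq₀ (norm_nonneg _) hsin, norm_sub_sq_real, norm_smul, inner_smul_right, hw, hwh,
      Real.norm_eq_abs, mul_one, sq_abs, Real.sin_sq, hcos]
    ring
  have hdecomp : ⟪w, x⟫ =
      Real.cos (angle w wh) * ⟪wh, x⟫ + Real.sin (angle w wh) * ⟪v, x⟫ := by
    have huv : Real.sin (angle w wh) • v = w - Real.cos (angle w wh) • wh := by
      rw [hv, ← hnorm, ← hcos]
      rcases eq_or_ne (w - ⟪w, wh⟫ • wh) 0 with h | h
      · simp [h]
      · rw [smul_inv_smul₀ (norm_ne_zero_iff.mpr h)]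
    rw [← real_inner_smul_left v, huv, inner_sub_left, real_inner_smul_left]
    ring
  have hcompare : Real.sin (angle w wh) * Real.cos ε ≤ Real.cos (angle w wh) * Real.sin ε := by
    have h : 0 ≤ Real.sin (ε - angle w wh) :=
      Real.sin_nonneg_of_nonneg_of_le_pi (by linarith) (by linarith)
    rw [Real.sin_sub] at h
    linarith
  have hopp : Real.cos (angle w wh) * |⟪wh, x⟫| ≤ Real.sin (angle w wh) * |⟪v, x⟫| := by
    have h1 := mul_le_mul_of_nonneg_left (le_abs_self ⟪v, x⟫) hsin
    have h2 := mul_le_mul_of_nonneg_left (neg_abs_le ⟪v, x⟫) hsin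
    unfold sgn at hsgn
    rcases le_or_gt 0 ⟪wh, x⟫ with ha | ha <;> rcases le_or_gt 0 ⟪w, x⟫ with hb | hb
    · simp [ha, hb] at hsgn
    · rw [abs_of_nonneg ha]; linarith
    · rw [abs_of_neg ha]; linarith
    · simp [ha.not_ge, hb.not_ge] at hsgn
  rw [Real.tan_eq_sin_div_cos, div_div_eq_mul_div, div_le_iff₀ hsε]
  refine le_of_mul_le_mul_left ?_ hc
  calc Real.cos (angle w wh) * (t * Real.cos ε)
      = (Real.cos (angle w wh) * t) * Real.cos ε := by ring
    _ ≤ (Real.sin (angle w wh) * |⟪v, x⟫|) * Real.cos ε :=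
        mul_le_mul_of_nonneg_right ((mul_le_mul_of_nonneg_left hx.le hc.le).trans hopp) hcε.le
    _ = (Real.sin (angle w wh) * Real.cos ε) * |⟪v, x⟫| := by ring
    _ ≤ (Real.cos (angle w wh) * Real.sin ε) * |⟪v, x⟫| := by gcongr
    _ = Real.cos (angle w wh) * (|⟪v, x⟫| * Real.sin ε) := by ring
end

section
/- Let ε ∈ (0, 1/2), T > 0, let w, ŵ be distinct unit vectors in ℝᵈ with ∠(w, ŵ) ≤ ε, let τ, τ̂ ∈ ℝ with |τ − τ̂| ≤ ε and |τ̂| ≤ T, let γ > 0, and let v = (w − (w·ŵ)ŵ) / ‖w − (w·ŵ)ŵ‖₂. Then for every x ∈ ℝᵈ with sign(w·x + τ) ≠ sign(ŵ·x + τ̂) and |ŵ·x + τ̂| > γ, it holds that |v·x| ≥ (γ·cos ε − ε·(T + 1)) / sin ε. -/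
open scoped RealInnerProductSpace
open InnerProductGeometry

/-- General-halfspace analogue of Statement 7: at a disagreement point `x`
with `|wh·x + τh| > γ`, the normalized component `v` of `w` orthogonal to `wh` satisfies
`|v·x| ≥ (γ·cos ε − ε·(T+1))/sin ε`. -/
theorem disagreement_point_large_orthogonal_component_general
    (d : ℕ) (ε T : ℝ) (hε0 : 0 < ε) (hε2 : ε < 1/2) (hT : 0 < T)
    (w wh : EuclideanSpace ℝ (Fin d)) (hw : ‖w‖ = 1) (hwh : ‖wh‖ = 1)
    (hne : w ≠ wh) (hangle : angle w wh ≤ ε)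
    (τ τh : ℝ) (hττ : |τ - τh| ≤ ε) (hτh : |τh| ≤ T)
    (γ : ℝ) (hγ : 0 < γ)
    (v : EuclideanSpace ℝ (Fin d))
    (hv : v = ‖w - ⟪w, wh⟫ • wh‖⁻¹ • (w - ⟪w, wh⟫ • wh)) :
    ∀ x : EuclideanSpace ℝ (Fin d),
      sgn (⟪w, x⟫ + τ) ≠ sgn (⟪wh, x⟫ + τh) → γ < |⟪wh, x⟫ + τh| →
        (γ * Real.cos ε - ε * (T + 1)) / Real.sin ε ≤ |⟪v, x⟫| := by
  intro x hsgn hA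
  have hcosε : Real.cos ε ≤ ⟪w, wh⟫ := by
    have h := Real.cos_le_cos_of_nonneg_of_le_pi (angle_nonneg w wh)
      (by linarith [Real.pi_gt_three]) hangle
    rwa [cos_angle, hw, hwh, mul_one, div_one] at h
  have hcos := Real.one_sub_sq_div_two_le_cos (x := ε)
  have hsin : 0 < Real.sin ε := Real.sin_pos_of_pos_of_lt_pi hε0 (by linarith [Real.pi_gt_three])
  have hc1 : ⟪w, wh⟫ ≤ 1 := by
    have h := real_inner_le_norm w wh
    rwa [hw, hwh, mul_one] at h
  have hnorm : ‖w - ⟪w, wh⟫ • wh‖ ^ 2 = 1 - ⟪w, wh⟫ ^ 2 := by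
    rw [norm_sub_sq_real, inner_smul_right, norm_smul, hw, hwh, Real.norm_eq_abs, mul_one, sq_abs]
    ring
  have hdecomp : w = ⟪w, wh⟫ • wh + ‖w - ⟪w, wh⟫ • wh‖ • v := by
    rw [hv]
    by_cases h : w - ⟪w, wh⟫ • wh = 0
    · simpa [h] using sub_eq_zero.mp h
    · rw [smul_inv_smul₀ (norm_ne_zero_iff.mpr h)]
      abel
  have hinner : ⟪w, x⟫ = ⟪w, wh⟫ * ⟪wh, x⟫ + ‖w - ⟪w, wh⟫ • wh‖ * ⟪v, x⟫ := by
    conv_lhs => rw [hdecomp]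
    rw [inner_add_left, real_inner_smul_left, real_inner_smul_left]
  have hcpos : 0 < ⟪w, wh⟫ := by nlinarith
  have hs_nonneg := norm_nonneg (w - ⟪w, wh⟫ • wh)
  generalize ‖w - ⟪w, wh⟫ • wh‖ = s at *
  generalize ⟪w, wh⟫ = c at *
  generalize ⟪w, x⟫ = W at *
  generalize ⟪wh, x⟫ = H at *
  generalize ⟪v, x⟫ = V at *
  have hs : s ≤ Real.sin ε := by
    refine le_of_sq_le_sq ?_ hsin.le
    have hcosε_pos : 0 ≤ Real.cos ε := by nlinarith
    nlinarith [Real.sin_sq_add_cos_sq ε]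
  have hsV : s * |V| ≤ Real.sin ε * |V| := mul_le_mul_of_nonneg_right hs (abs_nonneg V)
  have hsabs : s * |V| = |s * V| := by rw [abs_mul, abs_of_nonneg hs_nonneg]
  have hγc : γ * Real.cos ε ≤ c * γ := by nlinarith
  have hAc : c * γ ≤ c * |H + τh| := mul_le_mul_of_nonneg_left hA.le hcpos.le
  have hshift : |(1 - c) * τh| ≤ ε * T := by
    rw [abs_mul, abs_of_nonneg (by linarith)]
    exact mul_le_mul (by nlinarith) hτh (abs_nonneg _) hε0.le
  have hW : W + τ = c * (H + τh) + s * V + (τ - τh) + (1 - c) * τh := by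
    rw [hinner]; ring
  rw [div_le_iff₀ hsin]
  have h1 := abs_le.mp hshift
  have h2 := abs_le.mp hττ
  unfold sgn at hsgn
  split_ifs at hsgn with hB hA' hA'
  · exact absurd rfl hsgn
  · rw [abs_of_neg (not_le.mp hA')] at hAc
    linarith [le_abs_self (s * V)]
  · rw [abs_of_nonneg hA'] at hAc
    linarith [neg_abs_le (s * V)]
  · exact absurd rfl hsgn
end

section
/- There exists ε₀ > 0 such that for every ε ∈ (0, ε₀), setting k₀ = ln(1/ε) / (100·ln ln(1/ε)), there exists a probability measure D₁ on ℝ supported on a finite set that satisfies: (i) |∫ xⁱ dD₁(x) − ∫ xⁱ dN(0,1)(x)| ≤ k₀^{−10k₀} for every integer i with 0 ≤ i ≤ 10k₀, and (ii) there exists t ∈ ℝ with Pr_{x∼N(0,1)}[x ≥ t] ≤ ε^{(1/4)·ln(1/ε)} and Pr_{x∼D₁}[x ≥ t] ≥ 12ε. -/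
open MeasureTheory ProbabilityTheory

/-- A measure with finite moments can be pushed forward along a simple function so that finitely
many moments are approximated arbitrarily well. -/
theorem exists_simpleFunc_moments_close {μ : Measure ℝ}
    (hμ : ∀ i : ℕ, Integrable (fun x ↦ x ^ i) μ) (N : ℕ) {δ : ℝ} (hδ : 0 < δ) :
    ∃ s : SimpleFunc ℝ ℝ, ∀ i ≤ N, |(∫ x, s x ^ i ∂μ) - ∫ x, x ^ i ∂μ| ≤ δ := by
  let s : ℕ → SimpleFunc ℝ ℝ :=
    SimpleFunc.approxOn id measurable_id Set.univ 0 (Set.mem_univ _)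
  have hlim (i : ℕ) :
      Filter.Tendsto (fun n ↦ ∫ x, s n x ^ i ∂μ) Filter.atTop (nhds (∫ x, x ^ i ∂μ)) := by
    refine tendsto_integral_of_dominated_convergence (fun x ↦ 2 ^ i * ‖x ^ i‖) (fun n ↦ ?_)
      ((hμ i).norm.const_mul _) (fun n ↦ ?_) ?_
    · exact ((s n).measurable.pow_const i).aestronglyMeasurable
    · refine Filter.Eventually.of_forall fun x ↦ ?_
      have h := SimpleFunc.norm_approxOn_zero_le (f := id) measurable_id (Set.mem_univ (0 : ℝ)) x n
      rw [norm_pow, norm_pow, ← mul_pow]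
      refine pow_le_pow_left₀ (norm_nonneg _) (h.trans_eq ?_) i
      simp [two_mul]
    · refine Filter.Eventually.of_forall fun x ↦ Filter.Tendsto.pow ?_ i
      exact SimpleFunc.tendsto_approxOn measurable_id (Set.mem_univ (0 : ℝ)) (by simp)
  have hev : ∀ᶠ n in Filter.atTop, ∀ i ∈ Finset.range (N + 1),
      |(∫ x, s n x ^ i ∂μ) - ∫ x, x ^ i ∂μ| ≤ δ := by
    rw [Filter.eventually_all_finset]
    intro i _
    filter_upwards [Metric.tendsto_nhds.1 (hlim i) δ hδ] with n hn
    exact hn.le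
  obtain ⟨n, hn⟩ := hev.exists
  exact ⟨s n, fun i hi ↦ hn i (Finset.mem_range.2 (Nat.lt_succ_of_le hi))⟩

/-- Every probability measure on `ℝ` with finite moments has its first `N` moments approximated
arbitrarily well by those of a finitely supported probability measure. -/
theorem exists_finite_support_moments_close {μ : Measure ℝ} [IsProbabilityMeasure μ]
    (hμ : ∀ i : ℕ, Integrable (fun x ↦ x ^ i) μ) (N : ℕ) {δ : ℝ} (hδ : 0 < δ) :
    ∃ D : Measure ℝ, IsProbabilityMeasure D ∧ (∃ S : Finset ℝ, D (↑S)ᶜ = 0) ∧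
      (∀ i : ℕ, Integrable (fun x ↦ x ^ i) D) ∧
      ∀ i ≤ N, |(∫ x, x ^ i ∂D) - ∫ x, x ^ i ∂μ| ≤ δ := by
  obtain ⟨s, hs⟩ := exists_simpleFunc_moments_close hμ N hδ
  have hpow (i : ℕ) (ν : Measure ℝ) : AEStronglyMeasurable (fun x : ℝ ↦ x ^ i) ν :=
    (continuous_pow i).aestronglyMeasurable
  refine ⟨μ.map s, Measure.isProbabilityMeasure_map s.measurable.aemeasurable,
    ⟨s.range, ?_⟩, fun i ↦ ?_, fun i hi ↦ ?_⟩
  · rw [Measure.map_apply s.measurable s.range.measurableSet.compl]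
    convert measure_empty (μ := μ)
    ext x
    simp
  · rw [integrable_map_measure (hpow i _) s.measurable.aemeasurable]
    exact SimpleFunc.integrable_of_isFiniteMeasure (s.map (· ^ i))
  · rw [integral_map s.measurable.aemeasurable (hpow i _)]
    exact hs i hi

/-- The mixture of a finitely supported probability measure with a point mass of weight `p`. -/
theorem exists_mixture_dirac {D : Measure ℝ} [IsProbabilityMeasure D]
    (hS : ∃ S : Finset ℝ, D (↑S)ᶜ = 0) (hD : ∀ i : ℕ, Integrable (fun x ↦ x ^ i) D)
    {p : ℝ} (hp0 : 0 ≤ p) (hp1 : p ≤ 1) (t : ℝ) :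
    ∃ D₁ : Measure ℝ, IsProbabilityMeasure D₁ ∧ (∃ S : Finset ℝ, D₁ (↑S)ᶜ = 0) ∧
      (∀ i : ℕ, ∫ x, x ^ i ∂D₁ = (1 - p) * (∫ x, x ^ i ∂D) + p * t ^ i) ∧
      p ≤ (D₁ (Set.Ici t)).toReal := by
  obtain ⟨S, hS⟩ := hS
  have hprob : IsProbabilityMeasure
      (ENNReal.ofReal (1 - p) • D + ENNReal.ofReal p • Measure.dirac t) := by
    constructor
    simp [← ENNReal.ofReal_add (sub_nonneg.2 hp1) hp0]
  refine ⟨_, hprob, ⟨insert t S, ?_⟩, fun i ↦ ?_, ?_⟩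
  · have hsub : D (↑(insert t S : Finset ℝ))ᶜ = 0 :=
      measure_mono_null (Set.compl_subset_compl.2 (by simp)) hS
    have hdirac : Measure.dirac t (↑(insert t S : Finset ℝ))ᶜ = 0 := by
      rw [Measure.dirac_apply' _ (Finset.measurableSet _).compl]
      simp
    rw [Measure.add_apply, Measure.smul_apply, Measure.smul_apply, hsub, hdirac]
    simp
  · rw [integral_add_measure ((hD i).smul_measure ENNReal.ofReal_ne_top)
      ((integrable_dirac (by simp)).smul_measure ENNReal.ofReal_ne_top),
      integral_smul_measure, integral_smul_measure, integral_dirac,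
      ENNReal.toReal_ofReal (sub_nonneg.2 hp1), ENNReal.toReal_ofReal hp0, smul_eq_mul,
      smul_eq_mul]
  · rw [← ENNReal.ofReal_le_iff_le_toReal (measure_ne_top _ _), Measure.add_apply,
      Measure.smul_apply, Measure.smul_apply]
    simp

theorem gaussianReal_Ici_le {t : ℝ} (ht : 0 ≤ t) :
    ((gaussianReal 0 1) (Set.Ici t)).toReal ≤ Real.exp (-(t ^ 2 / 2)) := by
  have h := measure_ge_le_exp_mul_mgf (μ := gaussianReal 0 1) (X := id) t ht
    (integrable_exp_mul_gaussianReal t)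
  rw [mgf_id_gaussianReal, ← Real.exp_add] at h
  refine h.trans (Real.exp_le_exp.2 (le_of_eq ?_))
  simp only [NNReal.coe_one]
  ring

theorem integrable_pow_gaussianReal (i : ℕ) :
    Integrable (fun x : ℝ ↦ x ^ i) (gaussianReal 0 1) :=
  integrable_pow_of_mem_interior_integrableExpSet (X := id)
    (by simp [integrableExpSet_id_gaussianReal]) i

theorem abs_moment_gaussianReal_le (i : ℕ) :
    |∫ x, x ^ i ∂(gaussianReal 0 1)| ≤
      (i.factorial : ℝ) * ∫ x, Real.exp |x| ∂(gaussianReal 0 1) := by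
  have hint : Integrable (fun x : ℝ ↦ Real.exp |x|) (gaussianReal 0 1) := by
    simpa using integrable_exp_mul_abs (X := id) (t := 1) (μ := gaussianReal 0 1)
      (integrable_exp_mul_gaussianReal 1) (integrable_exp_mul_gaussianReal (-1))
  refine abs_integral_le_integral_abs.trans ?_
  rw [← integral_const_mul]
  refine integral_mono (integrable_pow_gaussianReal i).abs (hint.const_mul _) fun x ↦ ?_
  have h := Real.pow_div_factorial_le_exp |x| (abs_nonneg x) i
  rw [div_le_iff₀ (by positivity)] at h
  simpa only [abs_pow, mul_comm] using h

theorem rpow_div_log_self {L : ℝ} (hL : 1 < L) (c : ℝ) :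
    L ^ (c * (L / Real.log L)) = Real.exp (c * L) := by
  rw [Real.rpow_def_of_pos (by linarith)]
  congr 1
  have := (Real.log_pos hL).ne'
  field_simp

/-- For all sufficiently small `ε > 0`, with
`k₀ = ln(1/ε)/(100 ln ln(1/ε))`, there is a finitely supported probability distribution `D₁`
on `ℝ` whose moments of degree up to `10k₀` match those of the standard Gaussian up to
`k₀^{−10k₀}`, while `D₁` puts mass at least `12ε` above a threshold `t` whose standard Gaussian
tail is at most `ε^{(1/4)ln(1/ε)}`. -/
theorem exists_momentMatching_heavyTail :
    ∃ ε₀ : ℝ, 0 < ε₀ ∧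
      ∀ ε : ℝ, 0 < ε → ε < ε₀ →
        ∀ k₀ : ℝ, k₀ = Real.log (1/ε) / (100 * Real.log (Real.log (1/ε))) →
          ∃ D₁ : Measure ℝ, IsProbabilityMeasure D₁ ∧
            (∃ S : Finset ℝ, D₁ (↑S)ᶜ = 0) ∧
            (∀ i : ℕ, (i : ℝ) ≤ 10 * k₀ →
              |(∫ x, x ^ i ∂D₁) - ∫ x, x ^ i ∂(gaussianReal 0 1)| ≤ k₀ ^ (-(10 * k₀))) ∧
            ∃ t : ℝ,
              ((gaussianReal 0 1) (Set.Ici t)).toReal ≤ ε ^ ((1/4) * Real.log (1/ε)) ∧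
              12 * ε ≤ (D₁ (Set.Ici t)).toReal := by
  set C : ℝ := ∫ x, Real.exp |x| ∂(gaussianReal 0 1)
  have hC : 0 ≤ C := integral_nonneg fun x ↦ (Real.exp_pos _).le
  refine ⟨Real.exp (-(3 + 60 * (1 + C))), Real.exp_pos _, ?_⟩
  rintro ε hε hε₀ k₀ hk₀
  obtain ⟨L, rfl⟩ : ∃ L, ε = Real.exp (-L) := ⟨-Real.log ε, by rw [neg_neg, Real.exp_log hε]⟩
  have hlog : Real.log (1 / Real.exp (-L)) = L := by
    rw [Real.exp_neg, one_div, inv_inv, Real.log_exp]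
  rw [hlog] at hk₀ ⊢
  have hL : 3 + 60 * (1 + C) < L := by
    have := Real.exp_lt_exp.1 hε₀
    linarith
  have hL1 : 1 < L := by linarith
  have hlogL : 1 ≤ Real.log L := by
    rw [Real.le_log_iff_exp_le (by linarith)]
    linarith [Real.exp_one_lt_three]
  have hk₀' : 10 * k₀ = (1 / 10) * (L / Real.log L) := by
    rw [hk₀]
    field_simp
    norm_num
  have hq_pos : 0 < L / Real.log L := by positivity
  have hq_le : L / Real.log L ≤ L := div_le_self (by linarith) hlogL
  have hk₀_pos : 0 < k₀ := by linarith
  have hk₀_le : k₀ ≤ L := by linarith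
  have hp1 : 12 * Real.exp (-L) ≤ 1 := by
    have h1 := Real.add_one_le_exp L
    rw [Real.exp_neg, ← div_eq_mul_inv, div_le_one (Real.exp_pos _)]
    linarith
  have htol : Real.exp (-(1 / 10) * L) ≤ k₀ ^ (-(10 * k₀)) := by
    rw [← rpow_div_log_self hL1, neg_mul, ← hk₀']
    exact Real.rpow_le_rpow_of_nonpos hk₀_pos hk₀_le (by linarith)
  obtain ⟨D, hDprob, hDS, hDint, hDclose⟩ :=
    exists_finite_support_moments_close integrable_pow_gaussianReal ⌊10 * k₀⌋₊
      (half_pos (Real.exp_pos (-(1 / 10) * L)))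
  obtain ⟨D₁, hprob, hS, hmom, htail⟩ :=
    exists_mixture_dirac hDS hDint (by positivity) hp1 L
  refine ⟨D₁, hprob, hS, fun i hi ↦ le_trans ?_ htol, L, ?_, htail⟩
  · have hLi : L ^ i ≤ Real.exp (1 / 10 * L) := by
      rw [← rpow_div_log_self hL1, ← hk₀', ← Real.rpow_natCast]
      exact Real.rpow_le_rpow_of_exponent_le hL1.le hi
    have hfact : (i.factorial : ℝ) ≤ L ^ i := by
      have h : (i.factorial : ℝ) ≤ (i : ℝ) ^ i := by exact_mod_cast Nat.factorial_le_pow i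
      exact h.trans (pow_le_pow_left₀ (by positivity) (by linarith) i)
    have hM : |∫ x, x ^ i ∂(gaussianReal 0 1)| ≤ Real.exp (1 / 10 * L) * C :=
      (abs_moment_gaussianReal_le i).trans
        (mul_le_mul_of_nonneg_right (hfact.trans hLi) hC)
    have hclose := hDclose i (Nat.le_floor hi)
    rw [hmom i]
    set M : ℝ := ∫ x, x ^ i ∂(gaussianReal 0 1)
    set M₀ : ℝ := ∫ x, x ^ i ∂D
    have hsmall : 12 * Real.exp (-L) * (Real.exp (1 / 10 * L) * (1 + C)) ≤
        Real.exp (-(1 / 10) * L) / 2 := by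
      have h1 : Real.exp (-(1 / 10) * L) =
          Real.exp (-L) * Real.exp (1 / 10 * L) * Real.exp (4 / 5 * L) := by
        rw [← Real.exp_add, ← Real.exp_add]
        ring_nf
      have h2 : 24 * (1 + C) ≤ Real.exp (4 / 5 * L) := by
        linarith [Real.add_one_le_exp (4 / 5 * L)]
      rw [h1]
      nlinarith [mul_le_mul_of_nonneg_left h2
        (mul_pos (Real.exp_pos (-L)) (Real.exp_pos (1 / 10 * L))).le]
    have hp0 : 0 ≤ 12 * Real.exp (-L) := by positivity
    calc |(1 - 12 * Real.exp (-L)) * M₀ + 12 * Real.exp (-L) * L ^ i - M|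
        = |(1 - 12 * Real.exp (-L)) * (M₀ - M) + 12 * Real.exp (-L) * (L ^ i - M)| := by
          ring_nf
      _ ≤ (1 - 12 * Real.exp (-L)) * |M₀ - M| + 12 * Real.exp (-L) * |L ^ i - M| := by
          refine (abs_add_le _ _).trans_eq ?_
          rw [abs_mul, abs_mul, abs_of_nonneg (sub_nonneg.2 hp1), abs_of_nonneg hp0]
      _ ≤ |M₀ - M| + 12 * Real.exp (-L) * (Real.exp (1 / 10 * L) * (1 + C)) := by
          refine add_le_add (mul_le_of_le_one_left (abs_nonneg _) (by linarith))
            (mul_le_mul_of_nonneg_left ?_ hp0)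
          refine (abs_sub _ _).trans ?_
          rw [abs_of_nonneg (by positivity : 0 ≤ L ^ i)]
          linarith
      _ ≤ Real.exp (-(1 / 10) * L) := by linarith
  · refine (gaussianReal_Ici_le (by linarith)).trans ?_
    rw [← Real.exp_mul]
    refine Real.exp_le_exp.2 ?_
    nlinarith [sq_nonneg L]
end

section
/- Let t > 0 and 0 < τ ≤ t, and let D' be the pushforward of the standard Gaussian N(0,1) under the map f : ℝ → ℝ defined by f(x) = t if x ∈ [0, τ] and f(x) = x otherwise. Then D'([t, ∞)) ≥ N(0,1)([t, ∞)) + N(0,1)([0, τ]), and for every integer i ≥ 1, |∫ xⁱ dD'(x) − ∫ xⁱ dN(0,1)(x)| ≤ tⁱ · N(0,1)([0, τ]). -/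
open MeasureTheory ProbabilityTheory

/-- Mass-transport construction: moving the Gaussian mass of `[0, τ]` to the
point `t` increases the mass of `[t, ∞)` by `N(0,1)([0,τ])` and perturbs each `i`-th moment
(`i ≥ 1`) by at most `tⁱ · N(0,1)([0,τ])`. -/
theorem pushforward_transport_moment_bounds
    (t τ : ℝ) (ht : 0 < t) (hτ0 : 0 < τ) (hτt : τ ≤ t)
    (f : ℝ → ℝ) (hf : f = fun x => if x ∈ Set.Icc 0 τ then t else x)
    (D' : Measure ℝ) (hD' : D' = Measure.map f (gaussianReal 0 1)) :
    (gaussianReal 0 1) (Set.Ici t) + (gaussianReal 0 1) (Set.Icc 0 τ) ≤ D' (Set.Ici t) ∧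
    ∀ i : ℕ, 1 ≤ i →
      |(∫ x, x ^ i ∂D') - ∫ x, x ^ i ∂(gaussianReal 0 1)| ≤
        t ^ i * ((gaussianReal 0 1) (Set.Icc 0 τ)).toReal := by
  have hS : MeasurableSet (Set.Icc 0 τ) := measurableSet_Icc
  have hfm : Measurable f := by
    rw [hf]
    exact Measurable.ite hS measurable_const measurable_id
  have : NullSingletonClass (gaussianReal 0 1) := nullSingletonClass_gaussianReal one_ne_zero
  subst hD'
  refine ⟨?_, fun i _ => ?_⟩
  · have hdisj : AEDisjoint (gaussianReal 0 1) (Set.Ici t) (Set.Icc 0 τ) := by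
      refine measure_mono_null (t := {t}) ?_ (measure_singleton t)
      rintro x ⟨hx, -, hxτ⟩
      exact le_antisymm (hxτ.trans hτt) hx
    rw [Measure.map_apply hfm measurableSet_Ici,
      ← measure_union₀ hS.nullMeasurableSet hdisj]
    refine measure_mono ?_
    intro x hx
    simp only [Set.mem_preimage, hf, Set.mem_Ici]
    split_ifs with h
    · exact le_rfl
    · exact hx.resolve_right h
  · have hint : Integrable (fun x : ℝ => x ^ i) (gaussianReal 0 1) := by
      have h := (memLp_id_gaussianReal (μ := 0) (v := 1) i).integrable_norm_pow'
      refine h.mono' (by fun_prop) (ae_of_all _ fun x => ?_)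
      simp
    have hint_ind : Integrable ((Set.Icc 0 τ).indicator fun x : ℝ => t ^ i - x ^ i)
        (gaussianReal 0 1) :=
      ((integrable_const (t ^ i)).sub hint).indicator hS
    have hdecomp : ∀ x, f x ^ i = x ^ i + (Set.Icc 0 τ).indicator (fun x => t ^ i - x ^ i) x := by
      intro x
      by_cases h : x ∈ Set.Icc 0 τ
      · rw [Set.indicator_of_mem h, hf]
        simp only [if_pos h]
        ring
      · rw [Set.indicator_of_notMem h, hf]
        simp only [if_neg h, add_zero]
    rw [integral_map hfm.aemeasurable (by fun_prop)]
    simp_rw [hdecomp]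
    rw [integral_add hint hint_ind, add_sub_cancel_left,
      integral_indicator hS, ← Real.norm_eq_abs]
    refine norm_setIntegral_le_of_norm_le_const (measure_lt_top _ _) fun x hx => ?_
    have h0 : 0 ≤ x ^ i := pow_nonneg hx.1 i
    have h1 : x ^ i ≤ t ^ i := pow_le_pow_left₀ hx.1 (hx.2.trans hτt) i
    rw [Real.norm_eq_abs, abs_of_nonneg (sub_nonneg.2 h1)]
    exact sub_le_self _ h0
end

section
/- There exists a positive integer k₁ such that for every integer k ≥ k₁ the following holds. Let D₀ be a probability measure supported on a finite subset of ℝ such that |∫ xⁱ dD₀(x) − ∫ xⁱ dN(0,1)(x)| ≤ k^{−10k} for every integer i with 0 ≤ i ≤ 10k. Then for every real polynomial p of degree at most k satisfying p(x₀) ≥ 0 for all x₀ in the support of D₀, one has ∫ p(x) dN(0,1)(x) ≥ 0.9·∫ p(x) dD₀(x). -/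
open MeasureTheory ProbabilityTheory

/-- The sum of the absolute values of the first `n` coefficients of a real polynomial. -/
noncomputable def coeffL1 (n : ℕ) (p : Polynomial ℝ) : ℝ :=
  ∑ i ∈ Finset.range n, |p.coeff i|

namespace coeffL1

lemma nonneg (n : ℕ) (p : Polynomial ℝ) : 0 ≤ coeffL1 n p :=
  Finset.sum_nonneg fun _ _ => abs_nonneg _

lemma C_mul (n : ℕ) (a : ℝ) (p : Polynomial ℝ) :
    coeffL1 n (Polynomial.C a * p) = |a| * coeffL1 n p := by
  simp [coeffL1, abs_mul, Finset.mul_sum]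

lemma sub_le (n : ℕ) (p q : Polynomial ℝ) :
    coeffL1 n (p - q) ≤ coeffL1 n p + coeffL1 n q := by
  simp only [coeffL1, ← Finset.sum_add_distrib, Polynomial.coeff_sub]
  exact Finset.sum_le_sum fun _ _ => abs_sub _ _

lemma sum_le {ι : Type*} (n : ℕ) (s : Finset ι) (p : ι → Polynomial ℝ) :
    coeffL1 n (∑ j ∈ s, p j) ≤ ∑ j ∈ s, coeffL1 n (p j) := by
  simp only [coeffL1, Polynomial.finsetSum_coeff]
  rw [Finset.sum_comm]
  exact Finset.sum_le_sum fun _ _ => Finset.abs_sum_le_sum_abs _ _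

lemma X_mul_le (n : ℕ) (p : Polynomial ℝ) : coeffL1 n (Polynomial.X * p) ≤ coeffL1 n p := by
  cases n with
  | zero => simp [coeffL1]
  | succ n =>
    simp only [coeffL1]
    rw [Finset.sum_range_succ', Finset.sum_range_succ]
    simp [Polynomial.coeff_X_mul]

lemma X_sub_C_mul_le (n : ℕ) (a : ℝ) (p : Polynomial ℝ) :
    coeffL1 n ((Polynomial.X - Polynomial.C a) * p) ≤ (1 + |a|) * coeffL1 n p := by
  rw [sub_mul]
  have h₁ := sub_le n (Polynomial.X * p) (Polynomial.C a * p)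
  have h₂ := X_mul_le n p
  rw [C_mul] at h₁
  linarith

lemma one_le (n : ℕ) : coeffL1 n 1 ≤ 1 := by
  simp only [coeffL1, Polynomial.coeff_one]
  have : ∀ i : ℕ, |if i = 0 then (1 : ℝ) else 0| = if i = 0 then 1 else 0 := by
    intro i; split_ifs <;> simp
  simp only [this, Finset.sum_ite_eq']
  split_ifs <;> norm_num

lemma prod_basisDivisor_le {ι : Type*} (n : ℕ) (s : Finset ι) (v : ι → ℝ) (x B : ℝ) (hB : 0 ≤ B)
    (h : ∀ j ∈ s, |(x - v j)⁻¹| * (1 + |v j|) ≤ B) :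
    coeffL1 n (∏ j ∈ s, Lagrange.basisDivisor x (v j)) ≤ B ^ s.card := by
  classical
  induction s using Finset.induction_on with
  | empty => simpa using one_le n
  | insert a s ha ih =>
    rw [Finset.prod_insert ha, Finset.card_insert_of_notMem ha, Lagrange.basisDivisor, mul_assoc,
      C_mul]
    have h₁ := ih fun j hj => h j (Finset.mem_insert_of_mem hj)
    have h₂ := h a (Finset.mem_insert_self a s)
    calc _ ≤ |(x - v a)⁻¹| * ((1 + |v a|) * coeffL1 n (∏ j ∈ s, Lagrange.basisDivisor x (v j))) := by
          gcongr
          exact X_sub_C_mul_le _ _ _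
      _ = (|(x - v a)⁻¹| * (1 + |v a|)) * coeffL1 n (∏ j ∈ s, Lagrange.basisDivisor x (v j)) := by
          ring
      _ ≤ B * B ^ s.card := mul_le_mul h₂ h₁ (nonneg _ _) hB
      _ = _ := by ring

/-- Coefficients are controlled by the values at well-separated nodes. -/
lemma le_of_nodes (n : ℕ) (p : Polynomial ℝ) (k : ℕ) (hp : p.natDegree ≤ k) (v : ℕ → ℝ) (B T : ℝ)
    (hB : 0 ≤ B) (hT : 0 ≤ T) (hv : Set.InjOn v (Finset.range (k + 1)))
    (h : ∀ i ∈ Finset.range (k + 1), ∀ j ∈ Finset.range (k + 1), i ≠ j →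
      |(v i - v j)⁻¹| * (1 + |v j|) ≤ B)
    (hval : ∀ i ∈ Finset.range (k + 1), |p.eval (v i)| ≤ T) :
    coeffL1 n p ≤ (k + 1) * (T * B ^ k) := by
  have hdeg : p.degree < (Finset.range (k + 1)).card := by
    rw [Finset.card_range]
    exact lt_of_le_of_lt Polynomial.degree_le_natDegree (by exact_mod_cast Nat.lt_succ_of_le hp)
  rw [Lagrange.eq_interpolate hv hdeg, Lagrange.interpolate_apply]
  refine (sum_le _ _ _).trans ?_
  have : ∀ i ∈ Finset.range (k + 1),
      coeffL1 n (Polynomial.C (p.eval (v i)) * Lagrange.basis (Finset.range (k + 1)) v i)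
        ≤ T * B ^ k := by
    intro i hi
    rw [C_mul]
    refine mul_le_mul (hval i hi) ?_ (nonneg _ _) hT
    have := prod_basisDivisor_le n ((Finset.range (k + 1)).erase i) v (v i) B hB fun j hj =>
      h i hi j (Finset.mem_of_mem_erase hj) (Finset.ne_of_mem_erase hj).symm
    rwa [Finset.card_erase_of_mem hi, Finset.card_range, Nat.add_sub_cancel] at this
  refine (Finset.sum_le_sum this).trans ?_
  simp

end coeffL1

lemma integrable_polynomial_gaussianReal (p : Polynomial ℝ) :
    Integrable (fun x => p.eval x) (gaussianReal 0 1) := by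
  have h : ∀ n : ℕ, Integrable (fun x : ℝ => x ^ n) (gaussianReal 0 1) := fun n =>
    integrable_pow_of_mem_interior_integrableExpSet (X := id) (by simp) n
  simp only [Polynomial.eval_eq_sum_range]
  exact integrable_finsetSum _ fun i _ => (h i).const_mul _

lemma le_gaussianReal_Icc {a b : ℝ} (ha : 0 ≤ a) (hab : a ≤ b) (hb : b ≤ 1) :
    (b - a) / 6 ≤ (gaussianReal 0 1).real (Set.Icc a b) := by
  rw [measureReal_def, gaussianReal_apply_eq_integral 0 one_ne_zero,
    ENNReal.toReal_ofReal (integral_nonneg fun x => gaussianPDFReal_nonneg _ _ _)]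
  have hpdf : ∀ x ∈ Set.Icc a b, (1 / 6 : ℝ) ≤ gaussianPDFReal 0 1 x := by
    intro x hx
    have hx2 : x ^ 2 ≤ 1 := by
      have := hx.1; have := hx.2
      nlinarith
    have h₁ : (1 / 2 : ℝ) ≤ Real.exp (-(x - 0) ^ 2 / (2 * ((1 : NNReal) : ℝ))) := by
      have := Real.add_one_le_exp (-(x - 0) ^ 2 / (2 * ((1 : NNReal) : ℝ)))
      simp only [NNReal.coe_one] at *
      linarith
    have h₂ : √(2 * Real.pi * ((1 : NNReal) : ℝ)) ≤ 3 := by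
      rw [Real.sqrt_le_left (by norm_num)]
      have := Real.pi_lt_four
      simp only [NNReal.coe_one]
      linarith
    have h₃ : (0 : ℝ) < √(2 * Real.pi * ((1 : NNReal) : ℝ)) := by
      apply Real.sqrt_pos.2
      simp [Real.pi_pos]
    rw [gaussianPDFReal_def]
    calc (1 / 6 : ℝ) = 3⁻¹ * (1 / 2) := by norm_num
      _ ≤ _ := mul_le_mul (inv_anti₀ h₃ h₂) h₁ (by norm_num) (inv_nonneg.2 h₃.le)
  have := setIntegral_mono_on (μ := volume) (s := Set.Icc a b) (f := fun _ => (1 / 6 : ℝ))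
    (by simp) (integrable_gaussianPDFReal 0 1).integrableOn measurableSet_Icc hpdf
  refine le_trans (le_of_eq ?_) this
  simp [measureReal_def, Real.volume_Icc, hab]
  ring

/-- On every subinterval of `[0, 1]` some value of `p` is controlled by the Gaussian `L²` norm. -/
lemma exists_sq_eval_le {a b : ℝ} (ha : 0 ≤ a) (hab : a < b) (hb : b ≤ 1) (p : Polynomial ℝ) :
    ∃ x ∈ Set.Icc a b,
      (b - a) / 6 * (p.eval x) ^ 2 ≤ ∫ y, (p.eval y) ^ 2 ∂(gaussianReal 0 1) := by
  have hG := le_gaussianReal_Icc ha hab.le hb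
  have hpos : 0 < (gaussianReal 0 1).real (Set.Icc a b) := lt_of_lt_of_le (by linarith) hG
  have hint : Integrable (fun x => (p.eval x) ^ 2) (gaussianReal 0 1) := by
    exact (integrable_polynomial_gaussianReal (p ^ 2)).congr
      (Filter.Eventually.of_forall fun x => Polynomial.eval_pow (p := p) 2)
  obtain ⟨x, hx, hle⟩ := exists_le_setAverage (μ := gaussianReal 0 1) (s := Set.Icc a b)
    (f := fun x => (p.eval x) ^ 2) (by intro h; simp [measureReal_def, h] at hpos)
    (measure_ne_top _ _) hint.integrableOn
  refine ⟨x, hx, ?_⟩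
  rw [setAverage_eq, smul_eq_mul] at hle
  calc _ ≤ (gaussianReal 0 1).real (Set.Icc a b) * (p.eval x) ^ 2 := by gcongr
    _ ≤ (gaussianReal 0 1).real (Set.Icc a b) * (((gaussianReal 0 1).real (Set.Icc a b))⁻¹ *
        ∫ y in Set.Icc a b, (p.eval y) ^ 2 ∂(gaussianReal 0 1)) := by gcongr
    _ = ∫ y in Set.Icc a b, (p.eval y) ^ 2 ∂(gaussianReal 0 1) := by
        field_simp
    _ ≤ _ := setIntegral_le_integral hint (by filter_upwards with x using sq_nonneg _)

lemma coeffL1_sq_le (n k : ℕ) (p : Polynomial ℝ) (hp : p.natDegree ≤ k) :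
    coeffL1 n p ^ 2 ≤ 12 * (k + 1) ^ 3 * (4 * (k + 1)) ^ (2 * k) *
      ∫ y, (p.eval y) ^ 2 ∂(gaussianReal 0 1) := by
  set E := ∫ y, (p.eval y) ^ 2 ∂(gaussianReal 0 1) with hE
  have hE0 : 0 ≤ E := integral_nonneg fun _ => sq_nonneg _
  have hN : (0 : ℝ) < 2 * (k + 1) := by positivity
  have hex : ∀ i : ℕ, ∃ x : ℝ, i ∈ Finset.range (k + 1) →
      (2 * i / (2 * (k + 1)) ≤ x ∧ x ≤ (2 * i + 1) / (2 * (k + 1))) ∧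
      (p.eval x) ^ 2 ≤ 12 * (k + 1) * E := by
    intro i
    by_cases hi : i ∈ Finset.range (k + 1)
    · have hi' : (i : ℝ) ≤ k := by
        exact_mod_cast Nat.lt_succ_iff.1 (Finset.mem_range.1 hi)
      obtain ⟨x, hx, hle⟩ := exists_sq_eval_le
        (a := 2 * i / (2 * (k + 1))) (b := (2 * i + 1) / (2 * (k + 1)))
        (by positivity) (by gcongr; linarith) (by rw [div_le_one hN]; linarith) p
      refine ⟨x, fun _ => ⟨hx, ?_⟩⟩
      have : ((2 * i + 1) / (2 * ((k : ℝ) + 1)) - 2 * i / (2 * (k + 1))) / 6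
          = 1 / (12 * (k + 1)) := by
        field_simp; ring
      rw [this, ← hE, one_div, inv_mul_le_iff₀ (by positivity)] at hle
      exact hle
    · exact ⟨0, fun h => absurd h hi⟩
  choose v hv using hex
  have hsep : ∀ i ∈ Finset.range (k + 1), ∀ j ∈ Finset.range (k + 1), i < j →
      1 / (2 * (k + 1)) ≤ v j - v i := by
    intro i hi j hj hij
    have h₁ := (hv i hi).1.2
    have h₂ := (hv j hj).1.1
    have hij' : (i : ℝ) + 1 ≤ j := by exact_mod_cast hij
    have : 1 / (2 * ((k : ℝ) + 1)) ≤ 2 * j / (2 * (k + 1)) - (2 * i + 1) / (2 * (k + 1)) := by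
      rw [← sub_div]
      gcongr
      linarith
    linarith
  have hsep' : ∀ i ∈ Finset.range (k + 1), ∀ j ∈ Finset.range (k + 1), i ≠ j →
      1 / (2 * (k + 1)) ≤ |v i - v j| := by
    intro i hi j hj hij
    rcases lt_or_gt_of_ne hij with h | h
    · have := hsep i hi j hj h
      rw [abs_sub_comm]
      exact this.trans (le_abs_self _)
    · exact (hsep j hj i hi h).trans (le_abs_self _)
  have hinv : (0 : ℝ) < 1 / (2 * (k + 1)) := by positivity
  have hinj : Set.InjOn v (Finset.range (k + 1)) := by
    intro i hi j hj hij
    by_contra hne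
    have := hsep' i hi j hj hne
    rw [hij, sub_self, abs_zero] at this
    linarith
  have key := coeffL1.le_of_nodes n p k hp v (4 * (k + 1)) (√(12 * (k + 1) * E))
    (by positivity) (Real.sqrt_nonneg _) hinj
    (by
      intro i hi j hj hij
      have h₁ : |(v i - v j)⁻¹| ≤ 2 * (k + 1) := by
        rw [abs_inv]
        have := inv_anti₀ hinv (hsep' i hi j hj hij)
        simpa using this
      have hj' : (j : ℝ) ≤ k := by
        exact_mod_cast Nat.lt_succ_iff.1 (Finset.mem_range.1 hj)
      have h₂ : |v j| ≤ 1 := by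
        have h₃ := (hv j hj).1
        have h₄ : (2 * (j : ℝ) + 1) / (2 * (k + 1)) ≤ 1 := by
          rw [div_le_one hN]; linarith
        have h₅ : (0 : ℝ) ≤ 2 * j / (2 * (k + 1)) := by positivity
        rw [abs_le]
        constructor <;> linarith
      calc _ ≤ (2 * ((k : ℝ) + 1)) * (1 + 1) := by gcongr
        _ = _ := by ring)
    (fun i hi => Real.abs_le_sqrt (hv i hi).2)
  calc coeffL1 n p ^ 2
      ≤ ((k + 1) * (√(12 * (k + 1) * E) * (4 * (k + 1)) ^ k)) ^ 2 :=
        pow_le_pow_left₀ (coeffL1.nonneg _ _) key 2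
    _ = (k + 1) ^ 2 * (√(12 * (k + 1) * E)) ^ 2 * ((4 * (k + 1)) ^ k) ^ 2 := by ring
    _ = _ := by
        rw [Real.sq_sqrt (by positivity), ← pow_mul, mul_comm k 2]
        ring

lemma integral_pow_gaussianReal_le (n : ℕ) (hn : Even n) :
    ∫ x, x ^ n ∂(gaussianReal 0 1) ≤ 4 * (n : ℝ) ^ n := by
  have hexp : ∀ t : ℝ, ∫ x, Real.exp (t * x) ∂(gaussianReal 0 1) = Real.exp (t ^ 2 / 2) := by
    intro t
    have := congrFun (mgf_id_gaussianReal (μ := 0) (v := 1)) t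
    simpa [mgf] using this
  have hi := fun t : ℝ => integrable_exp_mul_gaussianReal (μ := 0) (v := 1) t
  have hpt : ∀ x : ℝ, x ^ n ≤ n.factorial * (Real.exp (1 * x) + Real.exp (-1 * x)) := by
    intro x
    have h := Real.pow_div_factorial_le_exp |x| (abs_nonneg x) n
    rw [hn.pow_abs, div_le_iff₀ (by positivity), mul_comm] at h
    refine h.trans ?_
    gcongr
    rcases abs_cases x with ⟨h, _⟩ | ⟨h, _⟩ <;> rw [h] <;> simp [Real.exp_nonneg]
  have hpow : Integrable (fun x : ℝ => x ^ n) (gaussianReal 0 1) := by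
    simpa using integrable_polynomial_gaussianReal (Polynomial.X ^ n)
  have h := integral_mono hpow (((hi 1).add (hi (-1))).const_mul (n.factorial : ℝ)) hpt
  have heq : ∫ x, (n.factorial : ℝ) * ((fun x => Real.exp (1 * x)) + fun x => Real.exp (-1 * x)) x
      ∂(gaussianReal 0 1) = n.factorial * (Real.exp (1 / 2) + Real.exp (1 / 2)) := by
    rw [integral_const_mul]
    simp only [Pi.add_apply]
    rw [integral_add (hi 1) (hi (-1)), hexp, hexp]
    norm_num
  rw [heq] at h
  have h2 : Real.exp (1 / 2) ≤ 2 := by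
    have h3 : Real.exp (1 / 2) ^ 2 = Real.exp 1 := by
      rw [← Real.exp_nat_mul]; norm_num
    have := Real.exp_one_lt_d9
    by_contra! hlt
    nlinarith
  have h4 : (n.factorial : ℝ) ≤ (n : ℝ) ^ n := by exact_mod_cast n.factorial_le_pow
  calc _ ≤ (n.factorial : ℝ) * (Real.exp (1 / 2) + Real.exp (1 / 2)) := h
    _ ≤ (n : ℝ) ^ n * (2 + 2) := by gcongr
    _ = _ := by ring

lemma abs_integral_sub_le_of_moments {ι : Type*} {μ ν : Measure ℝ} {m : ℕ} {ε : ℝ}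
    (hμ : ∀ i : ℕ, Integrable (fun x : ℝ => x ^ i) μ)
    (hν : ∀ i : ℕ, Integrable (fun x : ℝ => x ^ i) ν)
    (h : ∀ i ≤ m, |(∫ x, x ^ i ∂μ) - ∫ x, x ^ i ∂ν| ≤ ε)
    (s : Finset ι) (c : ι → ℝ) (e : ι → ℕ) (he : ∀ i ∈ s, e i ≤ m) :
    |(∫ x, ∑ i ∈ s, c i * x ^ e i ∂μ) - ∫ x, ∑ i ∈ s, c i * x ^ e i ∂ν|
      ≤ (∑ i ∈ s, |c i|) * ε := by
  rw [integral_finsetSum _ fun i _ => (hμ _).const_mul _,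
    integral_finsetSum _ fun i _ => (hν _).const_mul _, ← Finset.sum_sub_distrib, Finset.sum_mul]
  refine (Finset.abs_sum_le_sum_abs _ _).trans (Finset.sum_le_sum fun i hi => ?_)
  rw [integral_const_mul, integral_const_mul, ← mul_sub, abs_mul]
  gcongr
  exact h _ (he i hi)

lemma eval_pow_four_le (k : ℕ) (p : Polynomial ℝ) (hp : p.natDegree ≤ k) (x : ℝ) :
    (p.eval x) ^ 4 ≤ coeffL1 (k + 1) p ^ 4 * (1 + x ^ (4 * k)) := by
  have h₁ : |p.eval x| ≤ coeffL1 (k + 1) p * (max 1 |x|) ^ k := by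
    rw [Polynomial.eval_eq_sum_range' (Nat.lt_succ_of_le hp), coeffL1, Finset.sum_mul]
    refine (Finset.abs_sum_le_sum_abs _ _).trans (Finset.sum_le_sum fun i hi => ?_)
    rw [abs_mul, abs_pow]
    gcongr
    calc |x| ^ i ≤ (max 1 |x|) ^ i := by gcongr; exact le_max_right _ _
      _ ≤ _ := pow_le_pow_right₀ (le_max_left _ _) (Nat.lt_succ_iff.1 (Finset.mem_range.1 hi))
  have h₂ : (max 1 |x|) ^ (4 * k) ≤ 1 + x ^ (4 * k) := by
    have hev : Even (4 * k) := ⟨2 * k, by ring⟩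
    have := hev.pow_nonneg x
    rcases max_cases 1 |x| with ⟨h, _⟩ | ⟨h, _⟩ <;> rw [h]
    · simpa
    · rw [hev.pow_abs]; linarith
  have hev : Even 4 := ⟨2, rfl⟩
  calc (p.eval x) ^ 4 = |p.eval x| ^ 4 := (hev.pow_abs _).symm
    _ ≤ (coeffL1 (k + 1) p * (max 1 |x|) ^ k) ^ 4 := by gcongr
    _ = coeffL1 (k + 1) p ^ 4 * (max 1 |x|) ^ (4 * k) := by rw [mul_pow, ← pow_mul, mul_comm k 4]
    _ ≤ _ := mul_le_mul_of_nonneg_left h₂ (pow_nonneg (coeffL1.nonneg _ _) _)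

lemma sq_mul_sq_le {s t : ℝ} (hs : 0 ≤ s) (ht : 0 ≤ t) : s ^ 2 * t ^ 2 ≤ s ^ 3 * t + t ^ 4 := by
  rcases le_total t s with h | h
  · nlinarith [mul_nonneg (mul_nonneg (sq_nonneg s) ht) (sub_nonneg.2 h), pow_nonneg ht 4]
  · nlinarith [mul_nonneg (sq_nonneg t) (mul_nonneg (sub_nonneg.2 h) (add_nonneg hs ht)),
      mul_nonneg (pow_nonneg hs 3) ht]

lemma node_constant_le {k : ℕ} (hk : 1000 ≤ k) :
    12 * ((k : ℝ) + 1) ^ 3 * (4 * (k + 1)) ^ (2 * k) ≤ ((k : ℝ) ^ k) ^ 4 := by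
  have hk' : (1000 : ℝ) ≤ k := by exact_mod_cast hk
  have h₁ : (64 : ℝ) ^ k ≤ (k : ℝ) ^ k := by gcongr; linarith
  have h₂ : (k : ℝ) ^ 4 ≤ (k : ℝ) ^ k := pow_le_pow_right₀ (by linarith) (by omega)
  have h₃ : 12 * ((k : ℝ) + 1) ^ 3 ≤ (k : ℝ) ^ 4 := by
    calc 12 * ((k : ℝ) + 1) ^ 3 ≤ 12 * (2 * k) ^ 3 := by gcongr; linarith
      _ = 96 * (k : ℝ) ^ 3 := by ring
      _ ≤ k * (k : ℝ) ^ 3 := by gcongr; linarith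
      _ = _ := by ring
  have h₄ : (4 * ((k : ℝ) + 1)) ^ (2 * k) ≤ ((k : ℝ) ^ k) ^ 3 := by
    calc (4 * ((k : ℝ) + 1)) ^ (2 * k) ≤ (8 * k) ^ (2 * k) :=
        pow_le_pow_left₀ (by positivity) (by linarith) _
      _ = 64 ^ k * ((k : ℝ) ^ k) ^ 2 := by
        rw [mul_pow, pow_mul, mul_comm 2 k, pow_mul (k : ℝ)]; norm_num
      _ ≤ (k : ℝ) ^ k * ((k : ℝ) ^ k) ^ 2 := by gcongr
      _ = _ := by ring
  calc _ ≤ (k : ℝ) ^ k * ((k : ℝ) ^ k) ^ 3 := by gcongr; exact h₃.trans h₂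
    _ = _ := by ring

lemma moment_constant_le {k : ℕ} (hk : 1000 ≤ k) :
    2 + 4 * ((4 * k : ℕ) : ℝ) ^ (4 * k) ≤ ((k : ℝ) ^ k) ^ 5 := by
  have hk' : (1000 : ℝ) ≤ k := by exact_mod_cast hk
  have h₀ : (1 : ℝ) ≤ (k : ℝ) ^ k := one_le_pow₀ (by linarith)
  have h₁ : 6 * (256 : ℝ) ^ k ≤ (k : ℝ) ^ k := by
    have h₂ : (6 : ℝ) ≤ 3 ^ k :=
      le_trans (by norm_num) (pow_le_pow_right₀ (by norm_num) (by omega : 2 ≤ k))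
    calc 6 * (256 : ℝ) ^ k ≤ 3 ^ k * 256 ^ k := by gcongr
      _ = 768 ^ k := by rw [← mul_pow]; norm_num
      _ ≤ _ := by gcongr; linarith
  have h₃ : ((4 * k : ℕ) : ℝ) ^ (4 * k) = 256 ^ k * ((k : ℝ) ^ k) ^ 4 := by
    push_cast
    rw [mul_pow, pow_mul, mul_comm 4 k, pow_mul (k : ℝ)]; norm_num
  have h₅ : (1 : ℝ) ≤ 256 ^ k * ((k : ℝ) ^ k) ^ 4 :=
    one_le_mul_of_one_le_of_one_le (one_le_pow₀ (by norm_num)) (one_le_pow₀ h₀)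
  rw [h₃]
  calc _ ≤ 6 * (256 : ℝ) ^ k * ((k : ℝ) ^ k) ^ 4 := by linarith
    _ ≤ (k : ℝ) ^ k * ((k : ℝ) ^ k) ^ 4 := by gcongr
    _ = _ := by ring

/-- The first-moment lower bound obtained from second and fourth moments, combined with the
closeness of first moments. -/
lemma le_of_moment_bounds {A K m₁ m₂ m₄ g₁ g₂ : ℝ} (hA : 0 ≤ A) (hK : 1000 ≤ K) (hm₁ : 0 ≤ m₁)
    (hg₂ : A ^ 2 ≤ K ^ 4 * g₂) (h₁ : |m₁ - g₁| ≤ A * (K ^ 10)⁻¹)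
    (h₂ : |m₂ - g₂| ≤ A ^ 2 * (K ^ 10)⁻¹) (h₄ : m₄ ≤ A ^ 4 * K ^ 5)
    (hint : (K ^ 5 * A) ^ 2 * m₂ ≤ (K ^ 5 * A) ^ 3 * m₁ + m₄) : 0.9 * m₁ ≤ g₁ := by
  have hKp : 0 < K := by linarith
  have h₁' := abs_le.1 h₁
  rcases hA.eq_or_lt with rfl | hA
  · linarith [h₁'.2]
  · have hlow : A ^ 2 * K ^ 6 ≤ K ^ 10 * m₂ + A ^ 2 := by
      have hg : m₂ + A ^ 2 * (K ^ 10)⁻¹ ≥ g₂ := by linarith [(abs_le.1 h₂).1]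
      have h := mul_le_mul_of_nonneg_left hg (by positivity : 0 ≤ K ^ 10)
      have e : K ^ 10 * (m₂ + A ^ 2 * (K ^ 10)⁻¹) = K ^ 10 * m₂ + A ^ 2 := by field_simp
      rw [e] at h
      calc A ^ 2 * K ^ 6 ≤ (K ^ 4 * g₂) * K ^ 6 := by gcongr
        _ = K ^ 10 * g₂ := by ring
        _ ≤ _ := h
    have hmul : A ^ 3 * (A * (K ^ 6 - 1 - K ^ 5)) ≤ A ^ 3 * (K ^ 15 * m₁) := by
      have h := mul_le_mul_of_nonneg_left hlow (by positivity : 0 ≤ A ^ 2)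
      linarith
    have hdiv := le_of_mul_le_mul_left hmul (by positivity)
    have hK5 : 1 ≤ K ^ 5 := one_le_pow₀ (by linarith)
    have hgap : 10 * K ^ 5 ≤ K ^ 6 - 1 - K ^ 5 := by nlinarith
    have hfin : K ^ 5 * (10 * A) ≤ K ^ 5 * (K ^ 10 * m₁) := by
      have h := mul_le_mul_of_nonneg_left hgap hA.le
      linarith
    have hlast := le_of_mul_le_mul_left hfin (by positivity)
    have hε : 10 * (A * (K ^ 10)⁻¹) ≤ m₁ := by
      rw [← mul_assoc, mul_inv_le_iff₀ (by positivity)]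
      linarith
    linarith [h₁'.2]

lemma integrable_of_finset_support {μ : Measure ℝ} [IsFiniteMeasure μ] {S : Finset ℝ}
    (hS : μ (↑S)ᶜ = 0) (f : ℝ → ℝ) : Integrable f μ := by
  have h : IntegrableOn f S μ := IntegrableOn.finset
  rwa [IntegrableOn, Measure.restrict_eq_self_of_ae_mem (show ∀ᵐ x ∂μ, x ∈ (S : Set ℝ) from hS)] at h

lemma ae_of_finset_support {μ : Measure ℝ} {S : Finset ℝ}
    (hS : μ (↑S)ᶜ = 0) {P : ℝ → Prop} (h : ∀ x, μ {x} ≠ 0 → P x) : ∀ᵐ x ∂μ, P x := by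
  have hnull : μ ((↑S)ᶜ ∪ ⋃ x ∈ S.filter fun x => μ {x} = 0, {x}) = 0 := by
    refine measure_union_null hS ((measure_biUnion_null_iff (Finset.countable_toSet _)).2 ?_)
    intro x hx
    exact (Finset.mem_filter.1 hx).2
  refine measure_mono_null (fun x hx => ?_) hnull
  by_cases hxS : x ∈ S
  · right
    have : μ {x} = 0 := by
      by_contra hne
      exact hx (h x hne)
    simp [hxS, this]
  · left
    simpa using hxS

/-- Infeasibility of the dual linear program: for all sufficiently large `k`,
if a finitely supported distribution `D₀` has moments up to degree `10k` within `k^{−10k}` of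
the standard Gaussian moments, then every polynomial `p` of degree at most `k` that is
nonnegative on the support of `D₀` satisfies `∫ p dN(0,1) ≥ 0.9 ∫ p dD₀`. -/
theorem dual_LP_infeasible :
    ∃ k₁ : ℕ, 0 < k₁ ∧
      ∀ k : ℕ, k₁ ≤ k →
        ∀ (D₀ : Measure ℝ) (S : Finset ℝ), IsProbabilityMeasure D₀ → D₀ (↑S)ᶜ = 0 →
          (∀ i : ℕ, i ≤ 10 * k →
            |(∫ x, x ^ i ∂D₀) - ∫ x, x ^ i ∂(gaussianReal 0 1)| ≤ ((k : ℝ) ^ (10 * k))⁻¹) →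
          ∀ p : Polynomial ℝ, p.natDegree ≤ k →
            (∀ x₀ : ℝ, D₀ {x₀} ≠ 0 → 0 ≤ p.eval x₀) →
            0.9 * (∫ x, p.eval x ∂D₀) ≤ ∫ x, p.eval x ∂(gaussianReal 0 1) := by
  refine ⟨1000, by norm_num, ?_⟩
  intro k hk D S hD hS hmom p hp hpos
  have hk' : (1000 : ℝ) ≤ k := by exact_mod_cast hk
  have hK : (1000 : ℝ) ≤ (k : ℝ) ^ k := hk'.trans (le_self_pow₀ (by linarith) (by omega))
  have hi := integrable_of_finset_support hS
  have hg : ∀ i : ℕ, Integrable (fun x : ℝ => x ^ i) (gaussianReal 0 1) := fun i => by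
    simpa using integrable_polynomial_gaussianReal (Polynomial.X ^ i)
  have hA := coeffL1.nonneg (k + 1) p
  rw [mul_comm 10 k, pow_mul] at hmom
  have heval : ∀ x, p.eval x = ∑ i ∈ Finset.range (k + 1), p.coeff i * x ^ i :=
    fun x => Polynomial.eval_eq_sum_range' (Nat.lt_succ_of_le hp) x
  have heval2 : ∀ x, (p.eval x) ^ 2 = ∑ ij ∈ Finset.range (k + 1) ×ˢ Finset.range (k + 1),
      (p.coeff ij.1 * p.coeff ij.2) * x ^ (ij.1 + ij.2) := by
    intro x
    rw [heval, sq, Finset.sum_mul_sum, Finset.sum_product]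
    refine Finset.sum_congr rfl fun i _ => Finset.sum_congr rfl fun j _ => ?_
    ring
  have h₁ := abs_integral_sub_le_of_moments (fun i => hi _) hg hmom (Finset.range (k + 1))
    p.coeff id (by intro i hi; have := Finset.mem_range.1 hi; simp only [id]; omega)
  have h₂ := abs_integral_sub_le_of_moments (fun i => hi _) hg hmom
    (Finset.range (k + 1) ×ˢ Finset.range (k + 1))
    (fun ij => p.coeff ij.1 * p.coeff ij.2) (fun ij => ij.1 + ij.2) (by
      intro ij hij
      have := Finset.mem_product.1 hij
      simp only [Finset.mem_range] at this
      omega)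
  have hsum : ∑ ij ∈ Finset.range (k + 1) ×ˢ Finset.range (k + 1),
      |p.coeff ij.1 * p.coeff ij.2| = coeffL1 (k + 1) p ^ 2 := by
    rw [coeffL1, sq, Finset.sum_mul_sum, Finset.sum_product]
    simp only [abs_mul]
  simp only [id, ← heval] at h₁
  simp only [← heval2, hsum] at h₂
  refine le_of_moment_bounds (K := (k : ℝ) ^ k) (m₂ := ∫ x, (p.eval x) ^ 2 ∂D)
    (m₄ := ∫ x, (p.eval x) ^ 4 ∂D) hA hK
    (integral_nonneg_of_ae (ae_of_finset_support hS hpos)) ((coeffL1_sq_le (k + 1) k p hp).trans ?_) h₁ h₂ ?_ ?_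
  · gcongr
    exact node_constant_le hk
  · have h := integral_mono (hi _) (hi _) (eval_pow_four_le k p hp)
    refine h.trans ?_
    rw [integral_const_mul, integral_add (hi _) (hi _)]
    have h₃ := abs_le.1 (hmom (4 * k) (by omega))
    have h₄ := integral_pow_gaussianReal_le (4 * k) ⟨2 * k, by ring⟩
    have h₅ := moment_constant_le hk
    have h₆ : (((k : ℝ) ^ k) ^ 10)⁻¹ ≤ 1 := inv_le_one_of_one_le₀ (one_le_pow₀ (by linarith))
    gcongr
    simp only [integral_const, probReal_univ, smul_eq_mul]
    linarith [h₃.2]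
  · rw [← integral_const_mul, ← integral_const_mul, ← integral_add (hi _) (hi _)]
    refine integral_mono_ae (hi _) (hi _) ?_
    filter_upwards [ae_of_finset_support hS hpos] with x hx
    exact sq_mul_sq_le (by positivity) hx
end

section
/- Let k be a nonnegative integer and let p be a real polynomial of degree at most k with ∫ (p(x))² dN(0,1)(x) ≤ 1. Then every coefficient of p has absolute value at most 2^{k+1}. -/
open MeasureTheory ProbabilityTheory

namespace Polynomial

theorem integrable_eval_gaussianReal (p : Polynomial ℝ) :
    Integrable (fun x => p.eval x) (gaussianReal 0 1) := by
  simp only [eval_eq_sum_range]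
  refine integrable_finsetSum _ fun i _ => Integrable.const_mul ?_ _
  have h := (memLp_id_gaussianReal (μ := 0) (v := 1) (i : NNReal)).integrable_norm_pow'
  refine (integrable_norm_iff (by fun_prop)).1 ?_
  simpa using h

theorem integrable_gaussianPDFReal_mul_eval (p : Polynomial ℝ) :
    Integrable (fun x => gaussianPDFReal 0 1 x * p.eval x) := by
  have h := integrable_eval_gaussianReal p
  rw [gaussianReal_of_var_ne_zero 0 one_ne_zero,
    integrable_withDensity_iff_integrable_smul' (measurable_gaussianPDF _ _)
      (Filter.Eventually.of_forall fun _ => gaussianPDF_lt_top)] at h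
  simpa [toReal_gaussianPDF] using h

theorem hasDerivAt_gaussianPDFReal_zero_one (x : ℝ) :
    HasDerivAt (gaussianPDFReal 0 1) (-x * gaussianPDFReal 0 1 x) x := by
  unfold gaussianPDFReal
  have h : HasDerivAt (fun y : ℝ => -(y - 0) ^ 2 / (2 * ((1 : NNReal) : ℝ))) (-x) x := by
    have h' := (((hasDerivAt_id x).sub_const 0).pow 2).neg.div_const (2 * ((1 : NNReal) : ℝ))
    convert! h' using 1
    simp
    ring
  convert! h.exp.const_mul (√(2 * Real.pi * ((1 : NNReal) : ℝ)))⁻¹ using 1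
  ring

/-- Gaussian integration by parts for polynomials. -/
theorem integral_mul_eval_gaussianReal (p : Polynomial ℝ) :
    ∫ x, (X * p).eval x ∂(gaussianReal 0 1) =
      ∫ x, (derivative p).eval x ∂(gaussianReal 0 1) := by
  rw [eq_comm, ← sub_eq_zero,
    ← integral_sub (integrable_eval_gaussianReal _) (integrable_eval_gaussianReal _),
    integral_gaussianReal_eq_integral_smul one_ne_zero]
  refine integral_eq_zero_of_hasDerivAt_of_integrable
    (f := fun x => gaussianPDFReal 0 1 x * p.eval x) (fun x => ?_) ?_
    (integrable_gaussianPDFReal_mul_eval p)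
  · convert! (hasDerivAt_gaussianPDFReal_zero_one x).mul (p.hasDerivAt x) using 1
    simp
    ring
  · refine (integrable_gaussianPDFReal_mul_eval (derivative p - X * p)).congr ?_
    exact Filter.Eventually.of_forall fun x => by simp only [smul_eq_mul, eval_sub (R := ℝ)]

/-- The probabilists' Hermite polynomials with real coefficients. -/
noncomputable def realHermite (n : ℕ) : Polynomial ℝ :=
  (hermite n).map (Int.castRingHom ℝ)

theorem integral_realHermite_mul (n : ℕ) (q : Polynomial ℝ) :
    ∫ x, (realHermite n * q).eval x ∂(gaussianReal 0 1) =
      ∫ x, (derivative^[n] q).eval x ∂(gaussianReal 0 1) := by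
  induction n generalizing q with
  | zero => simp [realHermite]
  | succ n ih =>
    have h : realHermite (n + 1) * q =
        X * (realHermite n * q) - derivative (realHermite n) * q := by
      simp only [realHermite, hermite_succ, Polynomial.map_sub, Polynomial.map_mul, map_X,
        derivative_map]
      ring
    simp only [Function.iterate_succ_apply]
    rw [← ih, h]
    simp only [eval_sub (R := ℝ)]
    rw [integral_sub (integrable_eval_gaussianReal _) (integrable_eval_gaussianReal _),
      integral_mul_eval_gaussianReal,
      ← integral_sub (integrable_eval_gaussianReal _) (integrable_eval_gaussianReal _)]
    congr 1 with x
    simp [derivative_mul]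

theorem integral_realHermite_mul_of_natDegree_le {n : ℕ} {q : Polynomial ℝ}
    (hq : q.natDegree ≤ n) :
    ∫ x, (realHermite n * q).eval x ∂(gaussianReal 0 1) = n.factorial * q.coeff n := by
  have h : derivative^[n] q = C (n.factorial * q.coeff n) := by
    ext m
    rw [coeff_iterate_derivative, coeff_C]
    split_ifs with hm
    · simp [hm, Nat.descFactorial_self]
    · rw [coeff_eq_zero_of_natDegree_lt (by omega), smul_zero]
  rw [integral_realHermite_mul, h]
  simp

theorem natDegree_realHermite (n : ℕ) : (realHermite n).natDegree = n := by
  rw [realHermite, (hermite_monic n).natDegree_map, natDegree_hermite]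

theorem coeff_realHermite_self (n : ℕ) : (realHermite n).coeff n = 1 := by
  simp [realHermite, coeff_map]

theorem _root_.Nat.doubleFactorial_odd_le_doubleFactorial_even (m : ℕ) :
    (2 * m + 1).doubleFactorial ≤ (2 * m + 1 + 1).doubleFactorial := by
  induction m with
  | zero => decide
  | succ m ih =>
    have h1 : 2 * (m + 1) + 1 = 2 * m + 1 + 2 := by ring
    have h2 : 2 * (m + 1) + 1 + 1 = 2 * m + 1 + 1 + 2 := by ring
    rw [h2, h1, Nat.doubleFactorial_add_two, Nat.doubleFactorial_add_two]
    exact Nat.mul_le_mul (by omega) ih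

theorem sq_coeff_realHermite_le (n j : ℕ) :
    (realHermite n).coeff j ^ 2 ≤ 2 ^ n * n.factorial := by
  rcases lt_or_ge n j with hnj | hjn
  · rw [realHermite, coeff_map, coeff_hermite_of_lt hnj]
    simp only [map_zero, ne_eq, OfNat.ofNat_ne_zero, not_false_eq_true, zero_pow]
    positivity
  rcases Nat.even_or_odd (n + j) with he | ho
  · obtain ⟨m, rfl⟩ : ∃ m, n = 2 * m + j := by
      obtain ⟨a, ha⟩ := he
      exact ⟨a - j, by omega⟩
    rw [realHermite, coeff_map, coeff_hermite_explicit]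
    have hdf : (2 * m - 1).doubleFactorial ^ 2 ≤ (2 * m).factorial := by
      cases m with
      | zero => simp
      | succ m =>
        have h1 : 2 * (m + 1) - 1 = 2 * m + 1 := by omega
        have h2 : 2 * (m + 1) = 2 * m + 1 + 1 := by omega
        rw [h1, h2, Nat.factorial_eq_mul_doubleFactorial, sq]
        exact Nat.mul_le_mul_right _ (Nat.doubleFactorial_odd_le_doubleFactorial_even m)
    have hch : (2 * m + j).choose j ≤ 2 ^ (2 * m + j) := Nat.choose_le_two_pow _ _
    have hfac : (2 * m + j).choose j * (2 * m).factorial ≤ (2 * m + j).factorial := by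
      have h := Nat.choose_mul_factorial_mul_factorial (Nat.le_add_left j (2 * m))
      rw [Nat.add_sub_cancel] at h
      rw [← h, mul_right_comm]
      exact Nat.le_mul_of_pos_right _ j.factorial_pos
    have hN : ((2 * m - 1).doubleFactorial * (2 * m + j).choose j) ^ 2 ≤
        2 ^ (2 * m + j) * (2 * m + j).factorial := by
      calc _ = (2 * m + j).choose j *
            ((2 * m + j).choose j * (2 * m - 1).doubleFactorial ^ 2) := by ring
        _ ≤ (2 * m + j).choose j * ((2 * m + j).choose j * (2 * m).factorial) := by gcongr
        _ ≤ _ := Nat.mul_le_mul hch hfac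
    have hR : (((2 * m - 1).doubleFactorial : ℝ) * (2 * m + j).choose j) ^ 2 ≤
        2 ^ (2 * m + j) * (2 * m + j).factorial := by exact_mod_cast hN
    refine le_of_eq_of_le ?_ hR
    simp only [map_mul, map_pow, map_neg, map_one, map_natCast, mul_assoc]
    rw [mul_pow, ← pow_mul, mul_comm m 2, pow_mul]
    simp
  · rw [realHermite, coeff_map, coeff_hermite_of_odd_add ho]
    simp only [map_zero, ne_eq, OfNat.ofNat_ne_zero, not_false_eq_true, zero_pow]
    positivity

theorem sq_coeff_le_two_pow_mul_integral (k : ℕ) (p : Polynomial ℝ) (hp : p.natDegree ≤ k)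
    (j : ℕ) :
    p.coeff j ^ 2 ≤ 2 ^ (k + 1) * ∫ x, (p.eval x) ^ 2 ∂(gaussianReal 0 1) := by
  induction k generalizing p with
  | zero =>
    obtain ⟨c, rfl⟩ : ∃ c, p = C c := ⟨_, eq_C_of_natDegree_le_zero hp⟩
    rw [coeff_C]
    split_ifs <;> simp <;> nlinarith [sq_nonneg c]
  | succ k ih =>
    set H := realHermite (k + 1) with hH
    set a := p.coeff (k + 1) with ha
    set r := p - C a * H with hr
    have hpr : p = C a * H + r := by rw [hr]; ring
    have hrdeg : r.natDegree ≤ k := by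
      rw [natDegree_le_iff_coeff_eq_zero]
      intro m hm
      rcases eq_or_lt_of_le (Nat.succ_le_of_lt hm) with rfl | hm'
      · simp [hr, hH, coeff_realHermite_self, ha]
      · rw [hr, coeff_sub, coeff_C_mul, coeff_eq_zero_of_natDegree_lt (by omega),
          coeff_eq_zero_of_natDegree_lt (by rw [hH, natDegree_realHermite]; omega)]
        simp
    have hHpr : ∫ x, (H * (p + r)).eval x ∂(gaussianReal 0 1) = (k + 1).factorial * a := by
      rw [hH, integral_realHermite_mul_of_natDegree_le
          (natDegree_add_le_of_degree_le hp (hrdeg.trans k.le_succ)), coeff_add,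
        coeff_eq_zero_of_natDegree_lt (p := r) (by omega), add_zero]
    have hsq : ∫ x, (p.eval x) ^ 2 ∂(gaussianReal 0 1) =
        (k + 1).factorial * a ^ 2 + ∫ x, (r.eval x) ^ 2 ∂(gaussianReal 0 1) := by
      have h : ∀ x, (p.eval x) ^ 2 =
          a * (H * (p + r)).eval x + (r ^ 2).eval x := by
        intro x
        rw [hpr]
        simp only [eval_add, eval_mul, eval_C, eval_pow]
        ring
      simp only [h]
      rw [integral_add ((integrable_eval_gaussianReal _).const_mul a)
          (integrable_eval_gaussianReal _), integral_const_mul, hHpr]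
      simp only [eval_pow]
      ring
    have hc : p.coeff j = a * H.coeff j + r.coeff j := by
      conv_lhs => rw [hpr]
      simp
    have h1 := mul_le_mul_of_nonneg_left (sq_coeff_realHermite_le (k + 1) j) (sq_nonneg a)
    have h2 := ih r hrdeg
    calc p.coeff j ^ 2 ≤ 2 * (a ^ 2 * H.coeff j ^ 2) + 2 * r.coeff j ^ 2 := by
          rw [hc]
          nlinarith [sq_nonneg (a * H.coeff j - r.coeff j)]
      _ ≤ 2 * (a ^ 2 * (2 ^ (k + 1) * (k + 1).factorial)) +
          2 * (2 ^ (k + 1) * ∫ x, (r.eval x) ^ 2 ∂(gaussianReal 0 1)) := by gcongr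
      _ = _ := by rw [hsq]; ring

end Polynomial

/-- A polynomial of degree at most `k` with Gaussian second moment at most 1
has all coefficients bounded by `2^{k+1}` in absolute value. -/
theorem coeff_bound_of_gaussian_L2_bound
    (k : ℕ) (p : Polynomial ℝ) (hdeg : p.natDegree ≤ k)
    (hL2 : (∫ x, (p.eval x) ^ 2 ∂(gaussianReal 0 1)) ≤ 1) :
    ∀ j : ℕ, |p.coeff j| ≤ 2 ^ (k + 1) := by
  intro j
  refine abs_le_of_sq_le_sq (b := (2 : ℝ) ^ (k + 1)) ?_ (by positivity)
  have hone : (1 : ℝ) ≤ 2 ^ (k + 1) := one_le_pow₀ one_le_two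
  calc p.coeff j ^ 2 ≤ 2 ^ (k + 1) * ∫ x, (p.eval x) ^ 2 ∂(gaussianReal 0 1) :=
        Polynomial.sq_coeff_le_two_pow_mul_integral k p hdeg j
    _ ≤ 2 ^ (k + 1) * 1 := by gcongr
    _ ≤ (2 ^ (k + 1)) ^ 2 := by nlinarith
end

section
/- Let (he_n) denote the probabilists' Hermite polynomials, defined by he₀(x) = 1, he₁(x) = x, and he_{n+1}(x) = x·he_n(x) − n·he_{n−1}(x) for n ≥ 1. Then for every n ≥ 0, every coefficient of he_n has absolute value at most 2ⁿ·√(n!). Equivalently, every coefficient of the orthonormalized Hermite polynomial H_n = he_n/√(n!) has absolute value at most 2ⁿ. -/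
open Polynomial

/-- The probabilists' Hermite polynomials, defined by `he₀ = 1`, `he₁ = X`, and the recurrence
`he_{n+1} = X·he_n − n·he_{n−1}` for `n ≥ 1`. -/
noncomputable def he : ℕ → Polynomial ℝ
  | 0 => 1
  | 1 => Polynomial.X
  | n + 2 => Polynomial.X * he (n + 1) - Polynomial.C ((n : ℝ) + 1) * he n

/-- The unnormalized form of the coefficient bound. -/
theorem abs_coeff_he_le (n j : ℕ) :
    |(he n).coeff j| ≤ 2 ^ n * Real.sqrt (Nat.factorial n) := by
  induction n using Nat.twoStepInduction generalizing j with
  | zero =>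
    simp only [he, coeff_one]
    split_ifs <;> simp
  | one =>
    simp only [he, coeff_X]
    split_ifs <;> simp
  | more n ih₀ ih₁ =>
    have hX : |(X * he (n + 1)).coeff j| ≤ 2 ^ (n + 1) * Real.sqrt (Nat.factorial (n + 1)) := by
      cases j with
      | zero =>
        rw [coeff_X_mul_zero, abs_zero]
        positivity
      | succ j =>
        rw [coeff_X_mul]
        exact ih₁ j
    have hn : (0 : ℝ) ≤ (n : ℝ) + 1 := by positivity
    have hC : |((n : ℝ) + 1) * (he n).coeff j|
        ≤ ((n : ℝ) + 1) * (2 ^ n * Real.sqrt (Nat.factorial n)) := by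
      rw [abs_mul, abs_of_nonneg hn]
      exact mul_le_mul_of_nonneg_left (ih₀ j) hn
    have hs₁ : Real.sqrt (Nat.factorial (n + 1))
        = Real.sqrt ((n : ℝ) + 1) * Real.sqrt (Nat.factorial n) := by
      rw [← Real.sqrt_mul hn, Nat.factorial_succ]
      push_cast
      rfl
    have hs₂ : Real.sqrt (Nat.factorial (n + 2))
        = Real.sqrt ((n : ℝ) + 2) * Real.sqrt (Nat.factorial (n + 1)) := by
      rw [← Real.sqrt_mul (by positivity), Nat.factorial_succ (n + 1)]
      push_cast
      ring_nf
    have ha : 1 ≤ Real.sqrt ((n : ℝ) + 1) := Real.one_le_sqrt.2 (by simp)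
    have hab : Real.sqrt ((n : ℝ) + 1) ≤ Real.sqrt ((n : ℝ) + 2) :=
      Real.sqrt_le_sqrt (by linarith)
    have haa := Real.mul_self_sqrt hn
    simp only [he, coeff_sub, coeff_C_mul]
    refine (abs_sub _ _).trans ((add_le_add hX hC).trans ?_)
    rw [hs₂, hs₁]
    generalize Real.sqrt ((n : ℝ) + 1) = a at *
    generalize Real.sqrt ((n : ℝ) + 2) = b at *
    have key : 2 * a + a * a ≤ 4 * (b * a) := by nlinarith
    calc 2 ^ (n + 1) * (a * Real.sqrt (Nat.factorial n))
          + ((n : ℝ) + 1) * (2 ^ n * Real.sqrt (Nat.factorial n))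
        = (2 * a + a * a) * (2 ^ n * Real.sqrt (Nat.factorial n)) := by rw [haa]; ring
      _ ≤ 4 * (b * a) * (2 ^ n * Real.sqrt (Nat.factorial n)) :=
        mul_le_mul_of_nonneg_right key (by positivity)
      _ = 2 ^ (n + 2) * (b * (a * Real.sqrt (Nat.factorial n))) := by ring

/-- Every coefficient of the probabilists' Hermite polynomial `he_n` has
absolute value at most `2ⁿ·√(n!)`; equivalently, every coefficient of the orthonormalized
Hermite polynomial `he_n/√(n!)` has absolute value at most `2ⁿ`. -/
theorem hermite_coeff_bound (n j : ℕ) :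
    |(he n).coeff j| ≤ 2 ^ n * Real.sqrt (Nat.factorial n) ∧
    |(he n).coeff j / Real.sqrt (Nat.factorial n)| ≤ 2 ^ n := by
  have hs : 0 < Real.sqrt (Nat.factorial n) :=
    Real.sqrt_pos.2 (Nat.cast_pos.2 n.factorial_pos)
  refine ⟨abs_coeff_he_le n j, ?_⟩
  rw [abs_div, abs_of_pos hs, div_le_iff₀ hs]
  exact abs_coeff_he_le n j
end
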